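/- Let N ≥ 2 be an integer, α ∈ (0,1), and G : ℤ^N → [0,∞) be such that Σ_{a∈ℕ^N} α^{a_1+…+a_N} G(x_N−a_N, …, x_1−a_1) < ∞ for every (x_N,…,x_1) ∈ ℤ^N. Assume that for every k ∈ {1,…,N−1} and every (x_N,…,x_1) ∈ ℤ^N: Σ_{m,n=0}^{∞} (1−α) α^{m+n} G(x_N, …, x_{k+2}, x_k−m−1, x_k−n, x_{k−1}, …, x_1) = Σ_{m=0}^{∞} α^{m} G(x_N, …, x_{k+2}, x_k−m−1, x_k, x_{k−1}, …, x_1), where the two displayed arguments occupy the slots of x_{k+1} and x_k. Then for every configuration with x_N < x_{N−1} < … < x_1, setting k_i := x_i − x_{i+1} for 1 ≤ i ≤ N−1: Σ_{a∈ℕ^N} (1−α)^{N} α^{a_1+…+a_N} G(x_N−a_N, …, x_1−a_1) = Σ_{μ ⊆ {1,…,N−1}} (1−α)^{|μ̄|+1} · α^{Σ_{j∈μ}(k_j−1)} · Σ_{a_N ≥ 0} Σ_{(a_i)_{i∈μ̄}, 0 ≤ a_i ≤ k_i−2} α^{a_N + Σ_{i∈μ̄} a_i} · G(x^{(μ)}_N,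 …, x^{(μ)}_1), where μ̄ = {1,…,N−1}∖μ, x^{(μ)}_i = x_{i+1}+1 for i ∈ μ, and x^{(μ)}_i = x_i − a_i for i ∈ μ̄ ∪ {N}. -/

import Mathlib

/-- Extend a jump vector `a : Fin N → ℕ` (indexed `0,…,N−1` for particles
`1,…,N`) to a function on `ℕ`, with `extFun N a i = a (i−1)` for `1 ≤ i ≤ N`
and `0` otherwise. -/
def extFun (N : ℕ) (a : Fin N → ℕ) : ℕ → ℕ := fun i =>
  if h : 1 ≤ i ∧ i ≤ N then a ⟨i - 1, by omega⟩ else 0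

open scoped ENNReal

/-- Geometric law with ratio `q`, with the mass of `[K, ∞)` collapsed onto `K`. -/
noncomputable def truncWeight (p q : ℝ≥0∞) (K n : ℕ) : ℝ≥0∞ :=
  (if n = K then q ^ K else 0) + (if n < K then p * q ^ n else 0)

/-- Jump weights where the particles with label below `j` have truncated law. -/
noncomputable def jumpWeight (p q : ℝ≥0∞) (K : ℕ → ℕ) (j i n : ℕ) : ℝ≥0∞ :=
  if i < j then truncWeight p q (K i) n else p * q ^ n

theorem extFun_succ (N : ℕ) (a : Fin N → ℕ) (i : Fin N) : extFun N a (i + 1) = a i := by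
  have : 1 ≤ (i : ℕ) + 1 ∧ (i : ℕ) + 1 ≤ N := ⟨by omega, i.2⟩
  simp [extFun, this]

theorem sum_extFun (N : ℕ) (a : Fin N → ℕ) :
    ∑ i ∈ Finset.Icc 1 N, extFun N a i = ∑ i, a i := by
  rw [Finset.sum_congr rfl (fun i (_ : i ∈ Finset.univ) => (extFun_succ N a i).symm),
    Fin.sum_univ_eq_sum_range (fun i => extFun N a (i + 1)), Finset.range_eq_Ico,
    Finset.sum_Ico_add' (extFun N a) 0 N 1]
  rfl

theorem extFun_injective (N : ℕ) : Function.Injective (extFun N) := fun a b h => by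
  ext i
  rw [← extFun_succ N a i, h, extFun_succ]

/-- Coordinates `j` and `j + 1` of a jump vector can be split off from the others. -/
theorem exists_pair_equiv (N j : ℕ) (hj : 1 ≤ j) (hjN : j < N) :
    ∃ (R : Type) (e : (ℕ × ℕ) × R ≃ (Fin N → ℕ)) (r₀ : R),
      (∀ m n r i, extFun N (e ((m, n), r)) i =
        if i = j + 1 then m else if i = j then n else extFun N (e ((0, 0), r)) i) ∧
      ∀ i, extFun N (e ((0, 0), r₀)) i = 0 := by
  refine ⟨{i : Fin N // (i : ℕ) ≠ j ∧ (i : ℕ) ≠ j - 1} → ℕ,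
    { toFun := fun s i => if h : (i : ℕ) = j then s.1.1 else
        if h' : (i : ℕ) = j - 1 then s.1.2 else s.2 ⟨i, h, h'⟩
      invFun := fun a => ((a ⟨j, hjN⟩, a ⟨j - 1, by omega⟩), fun i => a i)
      left_inv := ?_
      right_inv := ?_ }, fun _ => 0, ?_, ?_⟩
  · rintro ⟨⟨m, n⟩, r⟩
    have h : j - 1 ≠ j := by omega
    simp only [dite_true, h, dite_false, Prod.mk.injEq, true_and]
    ext ⟨i, hi⟩
    simp [hi.1, hi.2]
  · intro a
    ext i
    dsimp only
    split_ifs with h h'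
    · congr 1; exact Fin.ext h.symm
    · congr 1; exact Fin.ext h'.symm
    · rfl
  · intro m n r i
    simp only [extFun, Equiv.coe_fn_mk]
    split_ifs <;> first | rfl | omega
  · intro i
    simp [extFun]

theorem tsum_geometric_collapse (p q : ℝ≥0∞) (K : ℕ) (H : ℕ → ℕ → ℝ≥0∞)
    (h : ∑' m, ∑' n, p * q ^ (m + n) * H m (K + n) = ∑' m, q ^ m * H m K) :
    ∑' m, ∑' n, (p * q ^ m) * (p * q ^ n) * H m n =
      ∑' m, ∑' n, (p * q ^ m) * truncWeight p q K n * H m n := by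
  have e1 : ∀ m, ∑' n, (p * q ^ m) * (p * q ^ n) * H m n =
      ∑ n ∈ Finset.range K, (p * q ^ m) * (p * q ^ n) * H m n +
        p * q ^ K * ∑' n, p * q ^ (m + n) * H m (K + n) := fun m => by
    rw [← ENNReal.summable.sum_add_tsum_nat_add' (k := K), ← ENNReal.tsum_mul_left]
    congr 1
    refine tsum_congr fun n => ?_
    rw [add_comm n K]
    ring
  have e2 : ∀ m, ∑' n, (p * q ^ m) * truncWeight p q K n * H m n =
      ∑ n ∈ Finset.range K, (p * q ^ m) * (p * q ^ n) * H m n +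
        p * q ^ K * (q ^ m * H m K) := fun m => by
    rw [tsum_eq_sum (s := Finset.range (K + 1)), Finset.sum_range_succ]
    · congr 1
      · refine Finset.sum_congr rfl fun n hn => ?_
        rw [Finset.mem_range] at hn
        simp [truncWeight, hn, hn.ne]
      · simp only [truncWeight, if_true, lt_irrefl, if_false, add_zero]
        ring
    · intro n hn
      rw [Finset.mem_range] at hn
      have h1 : n ≠ K := by omega
      have h2 : ¬ n < K := by omega
      simp [truncWeight, h1, h2]
  simp_rw [e1, e2]
  rw [ENNReal.tsum_add, ENNReal.tsum_add, ENNReal.tsum_mul_left, ENNReal.tsum_mul_left, h]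

theorem tsum_jumpWeight_succ (N : ℕ) (p q : ℝ≥0∞) (g : (ℕ → ℤ) → ℝ≥0∞) (x : ℕ → ℤ)
    (K : ℕ → ℕ) (hK : ∀ i, 1 ≤ i → i < N → (K i : ℤ) = x i - x (i + 1) - 1)
    (hbc : ∀ k : ℕ, 1 ≤ k → k < N → ∀ x : ℕ → ℤ,
      ∑' m : ℕ, ∑' n : ℕ, p * q ^ (m + n) *
        g (fun i => if i = k + 1 then x k - (m : ℤ) - 1
                    else if i = k then x k - (n : ℤ) else x i)
      = ∑' m : ℕ, q ^ m * g (fun i => if i = k + 1 then x k - (m : ℤ) - 1 else x i))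
    (j : ℕ) (hj : 1 ≤ j) (hjN : j < N) :
    ∑' a : Fin N → ℕ, (∏ i ∈ Finset.Icc 1 N, jumpWeight p q K j i (extFun N a i)) *
        g (fun i => x i - extFun N a i) =
      ∑' a : Fin N → ℕ, (∏ i ∈ Finset.Icc 1 N, jumpWeight p q K (j + 1) i (extFun N a i)) *
        g (fun i => x i - extFun N a i) := by
  obtain ⟨R, e, -, he, -⟩ := exists_pair_equiv N j hj hjN
  have hmem : j ∈ Finset.Icc 1 N := by rw [Finset.mem_Icc]; omega
  have hmem' : j + 1 ∈ (Finset.Icc 1 N).erase j := by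
    rw [Finset.mem_erase, Finset.mem_Icc]; omega
  have hprod : ∀ (w : ℕ → ℕ → ℝ≥0∞) m n r,
      ∏ i ∈ Finset.Icc 1 N, w i (extFun N (e ((m, n), r)) i) =
        w (j + 1) m * w j n * ∏ i ∈ ((Finset.Icc 1 N).erase j).erase (j + 1),
          w i (extFun N (e ((0, 0), r)) i) := fun w m n r => by
    rw [← Finset.mul_prod_erase _ _ hmem, ← Finset.mul_prod_erase _ _ hmem', ← mul_assoc]
    congr 1
    · simp [he m n r, mul_comm]
    · refine Finset.prod_congr rfl fun i hi => ?_
      simp only [Finset.mem_erase] at hi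
      rw [he m n r, if_neg hi.1, if_neg hi.2.1]
  have hsplit : ∀ F : (Fin N → ℕ) → ℝ≥0∞,
      ∑' a, F a = ∑' r, ∑' m, ∑' n, F (e ((m, n), r)) := fun F => by
    rw [← e.tsum_eq, ENNReal.tsum_prod', ENNReal.tsum_comm]
    exact tsum_congr fun r => ENNReal.tsum_prod'
  rw [hsplit, hsplit]
  refine tsum_congr fun r => ?_
  simp_rw [hprod]
  have hrest : ∏ i ∈ ((Finset.Icc 1 N).erase j).erase (j + 1),
        jumpWeight p q K (j + 1) i (extFun N (e ((0, 0), r)) i) =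
      ∏ i ∈ ((Finset.Icc 1 N).erase j).erase (j + 1),
        jumpWeight p q K j i (extFun N (e ((0, 0), r)) i) := by
    refine Finset.prod_congr rfl fun i hi => ?_
    simp only [Finset.mem_erase] at hi
    have : i < j + 1 ↔ i < j := by omega
    simp only [jumpWeight, this]
  rw [hrest]
  set C := ∏ i ∈ ((Finset.Icc 1 N).erase j).erase (j + 1),
        jumpWeight p q K j i (extFun N (e ((0, 0), r)) i)
  have key := tsum_geometric_collapse p q (K j)
    (fun m n => g (fun i => x i - extFun N (e ((m, n), r)) i)) (by
      have hKj := hK j hj hjN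
      refine Eq.trans (tsum_congr fun m => tsum_congr fun n => ?_)
        ((hbc j hj hjN (fun i => if i = j then x (j + 1) + 1
          else x i - extFun N (e ((0, 0), r)) i)).trans (tsum_congr fun m => ?_))
      all_goals
        congr 2
        ext i
        rw [he m]
        split_ifs <;> first | omega | (subst_vars; push_cast; omega))
  have w1 : ∀ m, jumpWeight p q K j (j + 1) m = p * q ^ m := fun m => by simp [jumpWeight]
  have w2 : ∀ m, jumpWeight p q K (j + 1) (j + 1) m = p * q ^ m := fun m => by simp [jumpWeight]
  have w3 : ∀ m, jumpWeight p q K j j m = p * q ^ m := fun m => by simp [jumpWeight]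
  have w4 : ∀ m, jumpWeight p q K (j + 1) j m = truncWeight p q (K j) m := fun m => by
    simp [jumpWeight]
  simp_rw [w1, w2, w3, w4]
  have comm : ∀ a b : ℝ≥0∞, a * C * b = C * (a * b) := fun a b => by ring
  simp_rw [comm, ENNReal.tsum_mul_left]
  rw [key]

theorem tsum_jumpWeight_eq (N : ℕ) (p q : ℝ≥0∞) (g : (ℕ → ℤ) → ℝ≥0∞) (x : ℕ → ℤ)
    (K : ℕ → ℕ) (hK : ∀ i, 1 ≤ i → i < N → (K i : ℤ) = x i - x (i + 1) - 1)
    (hbc : ∀ k : ℕ, 1 ≤ k → k < N → ∀ x : ℕ → ℤ,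
      ∑' m : ℕ, ∑' n : ℕ, p * q ^ (m + n) *
        g (fun i => if i = k + 1 then x k - (m : ℤ) - 1
                    else if i = k then x k - (n : ℤ) else x i)
      = ∑' m : ℕ, q ^ m * g (fun i => if i = k + 1 then x k - (m : ℤ) - 1 else x i))
    (j : ℕ) (hj : 1 ≤ j) (hjN : j ≤ N) :
    ∑' a : Fin N → ℕ, p ^ N * q ^ (∑ i, a i) * g (fun i => x i - extFun N a i) =
      ∑' a : Fin N → ℕ, (∏ i ∈ Finset.Icc 1 N, jumpWeight p q K j i (extFun N a i)) *
        g (fun i => x i - extFun N a i) := by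
  induction j, hj using Nat.le_induction with
  | base =>
    refine tsum_congr fun a => ?_
    congr 1
    have : ∀ i ∈ Finset.Icc 1 N, jumpWeight p q K 1 i (extFun N a i) =
        p * q ^ extFun N a i := fun i hi => by
      rw [Finset.mem_Icc] at hi
      rw [jumpWeight, if_neg (by omega)]
    rw [Finset.prod_congr rfl this, Finset.prod_mul_distrib, Finset.prod_const,
      Finset.prod_pow_eq_pow_sum, sum_extFun, Nat.card_Icc, Nat.add_sub_cancel]
  | succ j hj ih =>
    rw [ih (by omega), tsum_jumpWeight_succ N p q g x K hK hbc j hj (by omega)]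

theorem tsum_blocked (N : ℕ) (hN : 2 ≤ N) (p q : ℝ≥0∞) (g : (ℕ → ℤ) → ℝ≥0∞) (x : ℕ → ℤ)
    (K : ℕ → ℕ) (hK : ∀ i, 1 ≤ i → i < N → (K i : ℤ) = x i - x (i + 1) - 1)
    (μ : Finset ℕ) (hμ : μ ⊆ Finset.Icc 1 (N - 1)) :
    ∑' a : Fin N → ℕ, (∏ i ∈ μ, if extFun N a i = K i then q ^ K i else 0) *
        (∏ i ∈ Finset.Icc 1 (N - 1) \ μ,
          if extFun N a i < K i then p * q ^ extFun N a i else 0) *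
        (p * q ^ extFun N a N) * g (fun i => x i - extFun N a i) =
      p ^ ((Finset.Icc 1 (N - 1) \ μ).card + 1) * q ^ (∑ j ∈ μ, K j) *
        ∑' aN : ℕ, ∑ b ∈ Fintype.piFinset (fun i : Fin N =>
            if (i : ℕ) + 1 ∈ Finset.Icc 1 (N - 1) \ μ then Finset.range (K ((i : ℕ) + 1))
            else {0}),
          q ^ (aN + ∑ i, b i) *
          g (fun i => if i ∈ μ then x (i + 1) + 1
                      else if i = N then x N - (aN : ℤ)
                      else x i - extFun N b i) := by
  set S := Fintype.piFinset (fun i : Fin N =>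
    if (i : ℕ) + 1 ∈ Finset.Icc 1 (N - 1) \ μ then Finset.range (K ((i : ℕ) + 1)) else {0})
   
  let φ : ℕ × S → Fin N → ℕ := fun s i =>
    if (i : ℕ) + 1 ∈ μ then K (i + 1) else if (i : ℕ) + 1 = N then s.1 else s.2.1 i
  have hμN : ∀ i ∈ μ, 1 ≤ i ∧ i < N := fun i hi => by
    have := Finset.mem_Icc.1 (hμ hi)
    omega
  have hφ : ∀ s i, extFun N (φ s) i =
      if i ∈ μ then K i else if i = N then s.1 else extFun N s.2.1 i := fun s i => by
    rcases i with _ | i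
    · have h0 : 0 ∉ μ := fun h => by have := hμN 0 h; omega
      have h1 : 0 ≠ N := by omega
      simp [extFun, h0, h1]
    · by_cases hi : i < N
      · rw [extFun_succ N (φ s) ⟨i, hi⟩, extFun_succ N s.2.1 ⟨i, hi⟩]
      · have h0 : i + 1 ∉ μ := fun h => by have := hμN _ h; omega
        have h1 : i + 1 ≠ N := by omega
        have h2 : ¬ i + 1 ≤ N := by omega
        simp [extFun, h0, h1, h2]
  have hb : ∀ b ∈ S, ∀ i : Fin N, if (i : ℕ) + 1 ∈ Finset.Icc 1 (N - 1) \ μ then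
      b i < K (i + 1) else b i = 0 := fun b hb i => by
    have := Fintype.mem_piFinset.1 hb i
    split_ifs at this ⊢ <;> simpa using this
  have hb0 : ∀ b ∈ S, ∀ i ∉ Finset.Icc 1 (N - 1) \ μ, extFun N b i = 0 := fun b hbS i hi => by
    unfold extFun
    split_ifs with h
    · have := hb b hbS ⟨i - 1, by omega⟩
      rwa [show i - 1 + 1 = i by omega, if_neg hi] at this
    · rfl
  have hb1 : ∀ b ∈ S, ∀ i ∈ Finset.Icc 1 (N - 1) \ μ, extFun N b i < K i := fun b hbS i hi => by
    have hi' := Finset.mem_Icc.1 (Finset.mem_sdiff.1 hi).1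
    have := hb b hbS ⟨i - 1, by omega⟩
    simp only [show i - 1 + 1 = i by omega, if_pos hi] at this
    rwa [extFun, dif_pos (by omega)]
  have hNμ : N ∉ μ := fun h => by have := hμN N h; omega
  have hNd : N ∉ Finset.Icc 1 (N - 1) \ μ := fun h => by
    have := Finset.mem_Icc.1 (Finset.mem_sdiff.1 h).1
    omega
  have hinj : Function.Injective φ := by
    rintro ⟨m, b, hbS⟩ ⟨m', b', hbS'⟩ h
    have h' : ∀ i, extFun N (φ (m, ⟨b, hbS⟩)) i = extFun N (φ (m', ⟨b', hbS'⟩)) i := fun i => by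
      rw [h]
    simp only [hφ] at h'
    have hm : m = m' := by simpa [hNμ] using h' N
    have hbb : b = b' := by
      apply extFun_injective
      ext i
      by_cases hi : i ∈ Finset.Icc 1 (N - 1) \ μ
      · have h1 : i ≠ N := fun h => hNd (h ▸ hi)
        simpa [(Finset.mem_sdiff.1 hi).2, h1] using h' i
      · rw [hb0 b hbS i hi, hb0 b' hbS' i hi]
    subst hm hbb
    rfl
  rw [← hinj.tsum_eq, ENNReal.tsum_prod', ← ENNReal.tsum_mul_left]
  · refine tsum_congr fun m => ?_
    rw [tsum_fintype, Finset.mul_sum, ← Finset.sum_coe_sort S]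
    refine Finset.sum_congr rfl fun b _ => ?_
    have hd : ∀ i ∈ Finset.Icc 1 (N - 1) \ μ,
        extFun N (φ (m, b)) i = extFun N b.1 i := fun i hi => by
      have h1 : i ≠ N := fun h => hNd (h ▸ hi)
      rw [hφ, if_neg (Finset.mem_sdiff.1 hi).2, if_neg h1]
    have e1 : (∏ i ∈ μ, if extFun N (φ (m, b)) i = K i then q ^ K i else 0) =
        q ^ (∑ j ∈ μ, K j) := by
      rw [← Finset.prod_pow_eq_pow_sum]
      refine Finset.prod_congr rfl fun i hi => ?_
      simp [hφ, hi]
    have e2 : (∏ i ∈ Finset.Icc 1 (N - 1) \ μ,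
        if extFun N (φ (m, b)) i < K i then p * q ^ extFun N (φ (m, b)) i else 0) =
        p ^ (Finset.Icc 1 (N - 1) \ μ).card * q ^ (∑ i, b.1 i) := by
      have hsub : ∑ i ∈ Finset.Icc 1 (N - 1) \ μ, extFun N b.1 i = ∑ i, b.1 i := by
        rw [← sum_extFun]
        refine Finset.sum_subset (fun i hi => ?_) fun i _ hi => hb0 b.1 b.2 i hi
        have := Finset.mem_Icc.1 (Finset.mem_sdiff.1 hi).1
        rw [Finset.mem_Icc]
        omega
      rw [← hsub, ← Finset.prod_pow_eq_pow_sum, ← Finset.prod_const, ← Finset.prod_mul_distrib]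
      refine Finset.prod_congr rfl fun i hi => ?_
      rw [hd i hi, if_pos (hb1 b.1 b.2 i hi)]
    have e3 : extFun N (φ (m, b)) N = m := by simp [hφ, hNμ]
    have e4 : (fun i => x i - (extFun N (φ (m, b)) i : ℤ)) =
        fun i => if i ∈ μ then x (i + 1) + 1 else if i = N then x N - (m : ℤ)
          else x i - extFun N b.1 i := by
      ext i
      rw [hφ]
      split_ifs with h1 h2
      · rw [hK i (hμN i h1).1 (hμN i h1).2]
        ring
      · rw [h2]
      · rfl
    rw [e1, e2, e3, e4]
    ring
  · intro a ha
    rw [Function.mem_support] at ha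
    have ha1 := left_ne_zero_of_mul (left_ne_zero_of_mul (left_ne_zero_of_mul ha))
    have ha2 := right_ne_zero_of_mul (left_ne_zero_of_mul (left_ne_zero_of_mul ha))
    rw [Finset.prod_ne_zero_iff] at ha1 ha2
    have h1 : ∀ i ∈ μ, extFun N a i = K i := fun i hi => by
      by_contra h
      exact ha1 i hi (if_neg h)
    have h2 : ∀ i ∈ Finset.Icc 1 (N - 1) \ μ, extFun N a i < K i := fun i hi => by
      by_contra h
      exact ha2 i hi (if_neg h)
    refine ⟨(extFun N a N, ⟨fun i => if (i : ℕ) + 1 ∈ Finset.Icc 1 (N - 1) \ μ then a i else 0,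
      Fintype.mem_piFinset.2 fun i => ?_⟩), ?_⟩
    · split_ifs with h
      · rw [Finset.mem_range, ← extFun_succ N a i]
        exact h2 _ h
      · simp
    · ext i
      simp only [φ]
      split_ifs with h h' h''
      · rw [← h1 _ h, extFun_succ]
      · rw [← extFun_succ N a i, h']
      · rfl
      · exact absurd (Finset.mem_sdiff.2 ⟨Finset.mem_Icc.2 (by omega), h⟩) h''

theorem ennreal_forward_equation (N : ℕ) (hN : 2 ≤ N) (p q : ℝ≥0∞) (g : (ℕ → ℤ) → ℝ≥0∞)
    (x : ℕ → ℤ) (K : ℕ → ℕ) (hK : ∀ i, 1 ≤ i → i < N → (K i : ℤ) = x i - x (i + 1) - 1)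
    (hbc : ∀ k : ℕ, 1 ≤ k → k < N → ∀ x : ℕ → ℤ,
      ∑' m : ℕ, ∑' n : ℕ, p * q ^ (m + n) *
        g (fun i => if i = k + 1 then x k - (m : ℤ) - 1
                    else if i = k then x k - (n : ℤ) else x i)
      = ∑' m : ℕ, q ^ m * g (fun i => if i = k + 1 then x k - (m : ℤ) - 1 else x i)) :
    ∑' a : Fin N → ℕ, p ^ N * q ^ (∑ i, a i) * g (fun i => x i - extFun N a i) =
      ∑ μ ∈ (Finset.Icc 1 (N - 1)).powerset,
        p ^ ((Finset.Icc 1 (N - 1) \ μ).card + 1) * q ^ (∑ j ∈ μ, K j) *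
        ∑' aN : ℕ, ∑ b ∈ Fintype.piFinset (fun i : Fin N =>
            if (i : ℕ) + 1 ∈ Finset.Icc 1 (N - 1) \ μ then Finset.range (K ((i : ℕ) + 1))
            else {0}),
          q ^ (aN + ∑ i, b i) *
          g (fun i => if i ∈ μ then x (i + 1) + 1
                      else if i = N then x N - (aN : ℤ)
                      else x i - extFun N b i) := by
  rw [tsum_jumpWeight_eq N p q g x K hK hbc N (by omega) le_rfl]
  rw [Finset.sum_congr rfl fun μ hμ =>
    (tsum_blocked N hN p q g x K hK μ (Finset.mem_powerset.1 hμ)).symm]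
  rw [← Summable.tsum_finsetSum fun _ _ => ENNReal.summable]
  refine tsum_congr fun a => ?_
  rw [← Finset.sum_mul, ← Finset.sum_mul, ← Finset.prod_add]
  congr 1
  rw [show Finset.Icc 1 N = insert N (Finset.Icc 1 (N - 1)) by
      ext i; simp only [Finset.mem_insert, Finset.mem_Icc]; omega,
    Finset.prod_insert (by rw [Finset.mem_Icc]; omega), mul_comm]
  congr 1
  · refine Finset.prod_congr rfl fun i hi => ?_
    rw [Finset.mem_Icc] at hi
    rw [jumpWeight, if_pos (by omega), truncWeight]
  · simp [jumpWeight]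

theorem summable_pair (N : ℕ) (α : ℝ) (G : (ℕ → ℤ) → ℝ)
    (hGsum : ∀ x : ℕ → ℤ, Summable (fun a : Fin N → ℕ =>
      α ^ (∑ i, a i) * G (fun i => x i - extFun N a i)))
    (k : ℕ) (hk : 1 ≤ k) (hkN : k < N) (x : ℕ → ℤ) :
    Summable fun mn : ℕ × ℕ => α ^ (mn.1 + mn.2) *
      G (fun i => if i = k + 1 then x k - (mn.1 : ℤ) - 1
                  else if i = k then x k - (mn.2 : ℤ) else x i) := by
  obtain ⟨R, e, r₀, he, he0⟩ := exists_pair_equiv N k hk hkN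
  have hinj : Function.Injective fun mn : ℕ × ℕ => e (mn, r₀) := fun a b h =>
    (Prod.mk.inj (e.injective h)).1
  refine (summable_congr fun mn => ?_).1
    ((hGsum fun i => if i = k + 1 then x k - 1 else x i).comp_injective hinj)
  obtain ⟨m, n⟩ := mn
  simp only [Function.comp]
  congr 2
  · rw [← sum_extFun]
    simp_rw [he m n r₀, he0]
    rw [← Finset.sum_subset (s₁ := {k, k + 1})]
    · simp [add_comm]
    · intro i hi
      simp only [Finset.mem_insert, Finset.mem_singleton] at hi
      rw [Finset.mem_Icc]
      omega
    · intro i _ hi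
      simp only [Finset.mem_insert, Finset.mem_singleton, not_or] at hi
      rw [if_neg hi.2, if_neg hi.1]
  · ext i
    rw [he m n r₀, he0]
    split_ifs with h1 h2
    · ring
    · rw [h2]
    · simp

theorem ennreal_boundary_condition (N : ℕ) (α : ℝ) (hα0 : 0 < α) (hα1 : α < 1)
    (G : (ℕ → ℤ) → ℝ) (hG0 : ∀ v, 0 ≤ G v)
    (hGsum : ∀ x : ℕ → ℤ, Summable (fun a : Fin N → ℕ =>
      α ^ (∑ i, a i) * G (fun i => x i - extFun N a i)))
    (k : ℕ) (hk : 1 ≤ k) (hkN : k < N) (x : ℕ → ℤ)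
    (hbc : (∑' mn : ℕ × ℕ, (1 - α) * α ^ (mn.1 + mn.2) *
        G (fun i => if i = k + 1 then x k - (mn.1 : ℤ) - 1
                    else if i = k then x k - (mn.2 : ℤ) else x i))
      = ∑' m : ℕ, α ^ m *
        G (fun i => if i = k + 1 then x k - (m : ℤ) - 1 else x i)) :
    ∑' m : ℕ, ∑' n : ℕ, ENNReal.ofReal (1 - α) * ENNReal.ofReal α ^ (m + n) *
        ENNReal.ofReal (G (fun i => if i = k + 1 then x k - (m : ℤ) - 1
                    else if i = k then x k - (n : ℤ) else x i))
      = ∑' m : ℕ, ENNReal.ofReal α ^ m *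
        ENNReal.ofReal (G (fun i => if i = k + 1 then x k - (m : ℤ) - 1 else x i)) := by
  have hp : 0 ≤ 1 - α := by linarith
  have hs := summable_pair N α G hGsum k hk hkN x
  have hs1 : Summable fun mn : ℕ × ℕ => (1 - α) * α ^ (mn.1 + mn.2) *
      G (fun i => if i = k + 1 then x k - (mn.1 : ℤ) - 1
                  else if i = k then x k - (mn.2 : ℤ) else x i) := by
    simpa only [mul_assoc] using hs.mul_left (1 - α)
  have hs2 : Summable fun m : ℕ => α ^ m *
      G (fun i => if i = k + 1 then x k - (m : ℤ) - 1 else x i) := by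
    have hinj : Function.Injective fun m : ℕ => (m, 0) := fun a b h => (Prod.mk.inj h).1
    refine (summable_congr fun m => ?_).1 (hs.comp_injective hinj)
    simp only [Function.comp, add_zero]
    congr 2
    ext i
    split_ifs with h1 h2
    · rfl
    · simp [h2]
    · rfl
  have h := congrArg ENNReal.ofReal hbc
  rw [ENNReal.ofReal_tsum_of_nonneg (fun _ => mul_nonneg (by positivity) (hG0 _)) hs1,
    ENNReal.ofReal_tsum_of_nonneg (fun _ => mul_nonneg (by positivity) (hG0 _)) hs2,
    ENNReal.tsum_prod'] at h
  convert h using 5 with m n m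
  · rw [ENNReal.ofReal_mul (by positivity), ENNReal.ofReal_mul hp, ENNReal.ofReal_pow hα0.le]
  · rw [ENNReal.ofReal_mul (by positivity), ENNReal.ofReal_pow hα0.le]

/-- Equivalence between the product form of independent truncated-geometric
jumps and the one-step Kolmogorov forward equation of the discrete time
geometric TASEP with parallel update: for any nonnegative `G` satisfying the
summability assumption and the boundary conditions, and any strictly ordered
configuration `x_N < … < x_1` (with gaps `k_i = x_i − x_{i+1}`),
`Σ_{a∈ℕ^N} (1−α)^N α^{Σa} G(x_N−a_N,…,x_1−a_1)
 = Σ_{μ⊆{1,…,N−1}} (1−α)^{|μ̄|+1} α^{Σ_{j∈μ}(k_j−1)}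
   Σ_{a_N≥0} Σ_{(a_i)_{i∈μ̄}, 0≤a_i≤k_i−2} α^{a_N+Σ_{i∈μ̄}a_i} G(x^{(μ)})`,
where `μ̄ = {1,…,N−1}∖μ`, `x^{(μ)}_i = x_{i+1}+1` for `i ∈ μ`, and
`x^{(μ)}_i = x_i − a_i` for `i ∈ μ̄ ∪ {N}`. -/
theorem statement16 (N : ℕ) (hN : 2 ≤ N) (α : ℝ) (hα0 : 0 < α) (hα1 : α < 1)
    (G : (ℕ → ℤ) → ℝ) (hG0 : ∀ v, 0 ≤ G v)
    (hGsum : ∀ x : ℕ → ℤ, Summable (fun a : Fin N → ℕ =>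
      α ^ (∑ i, a i) * G (fun i => x i - extFun N a i)))
    (hbc : ∀ k : ℕ, 1 ≤ k → k < N → ∀ x : ℕ → ℤ,
      (∑' mn : ℕ × ℕ, (1 - α) * α ^ (mn.1 + mn.2) *
        G (fun i => if i = k + 1 then x k - (mn.1 : ℤ) - 1
                    else if i = k then x k - (mn.2 : ℤ) else x i))
      = ∑' m : ℕ, α ^ m *
        G (fun i => if i = k + 1 then x k - (m : ℤ) - 1 else x i))
    (x : ℕ → ℤ) (hx : ∀ i : ℕ, 1 ≤ i → i < N → x (i + 1) < x i) :
    (∑' a : Fin N → ℕ,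
      (1 - α) ^ N * α ^ (∑ i, a i) * G (fun i => x i - extFun N a i))
    = ∑ μ ∈ (Finset.Icc 1 (N - 1)).powerset,
        (1 - α) ^ ((Finset.Icc 1 (N - 1) \ μ).card + 1) *
        α ^ (∑ j ∈ μ, (x j - x (j + 1) - 1)) *
        ∑' aN : ℕ, ∑ b ∈ Fintype.piFinset (fun i : Fin N =>
            if (i : ℕ) + 1 ∈ Finset.Icc 1 (N - 1) \ μ then
              Finset.range ((x ((i : ℕ) + 1) - x ((i : ℕ) + 2) - 1).toNat)
            else {0}),
          α ^ (aN + ∑ i, b i) *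
          G (fun i => if i ∈ μ then x (i + 1) + 1
                      else if i = N then x N - (aN : ℤ)
                      else x i - extFun N b i) := by
  have hp : 0 < 1 - α := by linarith
  have hK : ∀ i, 1 ≤ i → i < N →
      (((x i - x (i + 1) - 1).toNat : ℕ) : ℤ) = x i - x (i + 1) - 1 := fun i h1 h2 => by
    have := hx i h1 h2
    exact Int.toNat_of_nonneg (by omega)
  have main := ennreal_forward_equation N hN (ENNReal.ofReal (1 - α)) (ENNReal.ofReal α)
    (fun v => ENNReal.ofReal (G v)) x (fun i => (x i - x (i + 1) - 1).toNat) hK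
    fun k hk hkN y => ennreal_boundary_condition N α hα0 hα1 G hG0 hGsum k hk hkN y (hbc k hk hkN y)
  have hs : Summable fun a : Fin N → ℕ =>
      (1 - α) ^ N * α ^ (∑ i, a i) * G (fun i => x i - extFun N a i) := by
    simpa only [mul_assoc] using (hGsum x).mul_left ((1 - α) ^ N)
  have hterm : ∀ a : Fin N → ℕ,
      ENNReal.ofReal (1 - α) ^ N * ENNReal.ofReal α ^ (∑ i, a i) *
        ENNReal.ofReal (G (fun i => x i - extFun N a i)) =
      ENNReal.ofReal ((1 - α) ^ N * α ^ (∑ i, a i) * G (fun i => x i - extFun N a i)) :=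
    fun a => by
      rw [ENNReal.ofReal_mul (by positivity), ENNReal.ofReal_mul (by positivity),
        ENNReal.ofReal_pow hp.le, ENNReal.ofReal_pow hα0.le]
  simp_rw [hterm] at main
  rw [← ENNReal.ofReal_tsum_of_nonneg (fun _ => mul_nonneg (by positivity) (hG0 _)) hs] at main
  have hfin : ∀ μ ∈ (Finset.Icc 1 (N - 1)).powerset, _ ≠ ⊤ :=
    ENNReal.sum_ne_top.1 (main ▸ ENNReal.ofReal_ne_top)
  have main' := congrArg ENNReal.toReal main
  rw [ENNReal.toReal_sum hfin, ENNReal.toReal_ofReal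
    (tsum_nonneg fun _ => mul_nonneg (by positivity) (hG0 _))] at main'
  rw [main']
  refine Finset.sum_congr rfl fun μ hμ => ?_
  have hexp : (∑ j ∈ μ, (x j - x (j + 1) - 1)) =
      ((∑ j ∈ μ, (x j - x (j + 1) - 1).toNat : ℕ) : ℤ) := by
    push_cast
    refine Finset.sum_congr rfl fun j hj => ?_
    have := Finset.mem_Icc.1 (Finset.mem_powerset.1 hμ hj)
    have := hx j (by omega) (by omega)
    omega
  rw [hexp, zpow_natCast, ENNReal.toReal_mul, ENNReal.toReal_mul, ENNReal.toReal_pow,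
    ENNReal.toReal_pow, ENNReal.toReal_ofReal hp.le, ENNReal.toReal_ofReal hα0.le,
    ENNReal.tsum_toReal_eq fun _ => ENNReal.sum_ne_top.2 fun _ _ =>
      ENNReal.mul_ne_top (ENNReal.pow_ne_top ENNReal.ofReal_ne_top) ENNReal.ofReal_ne_top]
  congr 1
  refine tsum_congr fun m => ?_
  rw [ENNReal.toReal_sum fun _ _ =>
      ENNReal.mul_ne_top (ENNReal.pow_ne_top ENNReal.ofReal_ne_top) ENNReal.ofReal_ne_top]
  refine Finset.sum_congr rfl fun b _ => ?_
  rw [ENNReal.toReal_mul, ENNReal.toReal_pow, ENNReal.toReal_ofReal hα0.le,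
    ENNReal.toReal_ofReal (hG0 _)]
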